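/- Let R be a ring with FPD(R) < ∞. Then the following are equivalent: (1) l.Ggldim(R) < ∞; (2) GP(R) = ^⊥(P̄(R)) and GP(R)^⊥ = P̄(R), where P̄(R) is the class of R-modules of finite projective dimension. -/

import Mathlib

universe u

open CategoryTheory

/-- `extVanish R n M N` asserts that `Ext_R^n(M, N) = 0`. -/
def extVanish (R : Type u) [Ring R] (n : ℕ) (M N : ModuleCat.{u} R) : Prop :=
  letI := HasDerivedCategory.standard (ModuleCat.{u} R)
  letI : HasExt.{u + 1} (ModuleCat.{u} R) := hasExt_of_hasDerivedCategory _
  Subsingleton (Abelian.Ext M N n)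

/-- A module `G` is Gorenstein projective if there is an exact sequence of projective
modules `⋯ → P i → P (i+1) → ⋯` with `G ≅ Im (d 0)` which stays exact after applying
`Hom_R(−, Q)` for every projective module `Q`. -/
def IsGorensteinProjective (R : Type u) [Ring R] (G : ModuleCat.{u} R) : Prop :=
  ∃ (P : ℤ → ModuleCat.{u} R) (d : ∀ i : ℤ, P i →ₗ[R] P (i + 1)),
    (∀ i, Module.Projective R (P i)) ∧
    (∀ i, LinearMap.range (d i) = LinearMap.ker (d (i + 1))) ∧
    Nonempty (G ≃ₗ[R] LinearMap.range (d 0)) ∧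
    ∀ (Q : ModuleCat.{u} R), Module.Projective R Q →
      ∀ (i : ℤ) (f : P (i + 1) →ₗ[R] Q), f ∘ₗ d i = 0 →
        ∃ g : P (i + 1 + 1) →ₗ[R] Q, g ∘ₗ d (i + 1) = f

/-- A module `G` is Gorenstein injective if there is an exact sequence of injective
modules `⋯ → I i → I (i+1) → ⋯` with `G ≅ Im (d 0)` which stays exact after applying
`Hom_R(E, −)` for every injective module `E`. -/
def IsGorensteinInjective (R : Type u) [Ring R] (G : ModuleCat.{u} R) : Prop :=
  ∃ (I : ℤ → ModuleCat.{u} R) (d : ∀ i : ℤ, I i →ₗ[R] I (i + 1)),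
    (∀ i, Module.Injective R (I i)) ∧
    (∀ i, LinearMap.range (d i) = LinearMap.ker (d (i + 1))) ∧
    Nonempty (G ≃ₗ[R] LinearMap.range (d 0)) ∧
    ∀ (E : ModuleCat.{u} R), Module.Injective R E →
      ∀ (i : ℤ) (f : E →ₗ[R] I (i + 1)), d (i + 1) ∘ₗ f = 0 →
        ∃ g : E →ₗ[R] I i, d i ∘ₗ g = f

/-- `gpdLE R n M` means that `M` admits a resolution `0 → Gₙ → ⋯ → G₀ → M → 0` by
Gorenstein projective modules, i.e. the Gorenstein projective dimension of `M` is at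
most `n`. -/
def gpdLE (R : Type u) [Ring R] : ℕ → ModuleCat.{u} R → Prop
  | 0, M => IsGorensteinProjective R M
  | n + 1, M => ∃ (K G : ModuleCat.{u} R) (f : K →ₗ[R] G) (g : G →ₗ[R] M),
      IsGorensteinProjective R G ∧ Function.Injective f ∧ Function.Surjective g ∧
      LinearMap.range f = LinearMap.ker g ∧ gpdLE R n K

/-- `gidLE R n M` means that `M` admits a coresolution `0 → M → G⁰ → ⋯ → Gⁿ → 0` by
Gorenstein injective modules, i.e. the Gorenstein injective dimension of `M` is at
most `n`. -/
def gidLE (R : Type u) [Ring R] : ℕ → ModuleCat.{u} R → Prop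
  | 0, M => IsGorensteinInjective R M
  | n + 1, M => ∃ (G C : ModuleCat.{u} R) (f : M →ₗ[R] G) (g : G →ₗ[R] C),
      IsGorensteinInjective R G ∧ Function.Injective f ∧ Function.Surjective g ∧
      LinearMap.range f = LinearMap.ker g ∧ gidLE R n C

/-- `projDimLE R n M` means that `M` admits a projective resolution of length at most `n`,
i.e. the projective dimension of `M` is at most `n`. -/
def projDimLE (R : Type u) [Ring R] : ℕ → ModuleCat.{u} R → Prop
  | 0, M => Module.Projective R M
  | n + 1, M => ∃ (K P : ModuleCat.{u} R) (f : K →ₗ[R] P) (g : P →ₗ[R] M),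
      Module.Projective R P ∧ Function.Injective f ∧ Function.Surjective g ∧
      LinearMap.range f = LinearMap.ker g ∧ projDimLE R n K

/-- `injDimLE R n M` means that `M` admits an injective resolution of length at most `n`,
i.e. the injective dimension of `M` is at most `n`. -/
def injDimLE (R : Type u) [Ring R] : ℕ → ModuleCat.{u} R → Prop
  | 0, M => Module.Injective R M
  | n + 1, M => ∃ (I C : ModuleCat.{u} R) (f : M →ₗ[R] I) (g : I →ₗ[R] C),
      Module.Injective R I ∧ Function.Injective f ∧ Function.Surjective g ∧
      LinearMap.range f = LinearMap.ker g ∧ injDimLE R n C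

/-- The projective dimension of `M` as an element of `ℕ∞` (`⊤` if no finite projective
resolution exists). -/
noncomputable def projDim (R : Type u) [Ring R] (M : ModuleCat.{u} R) : ℕ∞ :=
  sInf {n : ℕ∞ | ∃ m : ℕ, n = (m : ℕ∞) ∧ projDimLE R m M}

/-- The Gorenstein projective dimension of `M` as an element of `ℕ∞`. -/
noncomputable def gpd (R : Type u) [Ring R] (M : ModuleCat.{u} R) : ℕ∞ :=
  sInf {n : ℕ∞ | ∃ m : ℕ, n = (m : ℕ∞) ∧ gpdLE R m M}

/-- The finitistic projective dimension of `R`: the supremum of the projective dimensions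
of all modules of finite projective dimension. -/
noncomputable def FPD (R : Type u) [Ring R] : ℕ∞ :=
  ⨆ (M : ModuleCat.{u} R) (_ : projDim R M ≠ ⊤), projDim R M

/-- The left Gorenstein global dimension of `R`: the supremum of the Gorenstein projective
dimensions of all (left) `R`-modules. -/
noncomputable def leftGgldim (R : Type u) [Ring R] : ℕ∞ :=
  ⨆ M : ModuleCat.{u} R, gpd R M

section ShortExactSequences

variable {R : Type u} [Ring R]

/-- `0 → A → B → C → 0` is a short exact sequence. -/
structure IsSES {A B C : ModuleCat.{u} R} (f : A →ₗ[R] B) (g : B →ₗ[R] C) : Prop where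
  inj : Function.Injective f
  surj : Function.Surjective g
  exact : LinearMap.range f = LinearMap.ker g

lemma IsSES.apply_apply {A B C : ModuleCat.{u} R} {f : A →ₗ[R] B} {g : B →ₗ[R] C}
    (h : IsSES f g) (a : A) : g (f a) = 0 := by
  have : f a ∈ LinearMap.ker g := h.exact ▸ LinearMap.mem_range_self f a
  simpa using this

lemma IsSES.exists_of_apply_eq_zero {A B C : ModuleCat.{u} R} {f : A →ₗ[R] B} {g : B →ₗ[R] C}
    (h : IsSES f g) {b : B} (hb : g b = 0) : ∃ a, f a = b := by
  have : b ∈ LinearMap.range f := h.exact ▸ hb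
  simpa using this

lemma isSES_ker {B C : ModuleCat.{u} R} {g : B →ₗ[R] C} (hg : Function.Surjective g) :
    IsSES (A := ModuleCat.of R (LinearMap.ker g)) (LinearMap.ker g).subtype g :=
  ⟨Subtype.val_injective, hg, Submodule.range_subtype _⟩

lemma isSES_quotient {A B : ModuleCat.{u} R} {f : A →ₗ[R] B} (hf : Function.Injective f) :
    IsSES (C := ModuleCat.of R (B ⧸ LinearMap.range f)) f (LinearMap.range f).mkQ :=
  ⟨hf, Submodule.mkQ_surjective _, (Submodule.ker_mkQ _).symm⟩

/-- The short complex in the category of modules attached to a short exact sequence. -/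
abbrev IsSES.shortComplex {A B C : ModuleCat.{u} R} {f : A →ₗ[R] B} {g : B →ₗ[R] C}
    (h : IsSES f g) : ShortComplex (ModuleCat.{u} R) where
  X₁ := A
  X₂ := B
  X₃ := C
  f := ModuleCat.ofHom f
  g := ModuleCat.ofHom g
  zero := by
    ext a
    exact h.apply_apply a

lemma IsSES.shortExact {A B C : ModuleCat.{u} R} {f : A →ₗ[R] B} {g : B →ₗ[R] C}
    (h : IsSES f g) : h.shortComplex.ShortExact where
  exact := by
    rw [ShortComplex.moduleCat_exact_iff]
    intro b hb
    exact h.exists_of_apply_eq_zero hb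
  mono_f := (ModuleCat.mono_iff_injective _).2 h.inj
  epi_g := (ModuleCat.epi_iff_surjective _).2 h.surj

end ShortExactSequences

section ExtVanishing

open Abelian

variable {R : Type u} [Ring R] {n : ℕ} {A B C M N : ModuleCat.{u} R}
  {f : A →ₗ[R] B} {g : B →ₗ[R] C}

lemma extVanish_iff_subsingleton : extVanish R n M N ↔ Subsingleton (Ext.{u} M N n) := by
  have h : HasExt.{u + 1} (ModuleCat.{u} R) := HasExt.standard _
  have e : @Ext _ _ _ h M N n ≃ Ext.{u} M N n := @Ext.chgUniv.{u, u + 1} _ _ _ h inferInstance M N n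
  exact e.subsingleton_congr

lemma extVanish_iff : extVanish R n M N ↔ ∀ x : Ext.{u} M N n, x = 0 := by
  rw [extVanish_iff_subsingleton]
  exact ⟨fun _ x ↦ Subsingleton.elim _ _, fun h ↦ ⟨fun x y ↦ by rw [h x, h y]⟩⟩

lemma extVanish_of_projective (hM : Module.Projective R M) : extVanish R (n + 1) M N := by
  rw [extVanish_iff]
  have := (IsProjective.iff_projective M).1 hM
  exact fun x ↦ x.eq_zero_of_projective

lemma extVanish_of_injective (hN : Module.Injective R N) : extVanish R (n + 1) M N := by
  rw [extVanish_iff]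
  have := Module.injective_object_of_injective_module R N
  exact fun x ↦ x.eq_zero_of_injective

lemma extVanish_of_hasProjectiveDimensionLT (h : HasProjectiveDimensionLT M n) :
    extVanish R n M N :=
  extVanish_iff_subsingleton.2 (HasProjectiveDimensionLT.subsingleton M n n le_rfl N)

lemma extVanish_of_retract {G : ModuleCat.{u} R} {s : M →ₗ[R] G} {r : G →ₗ[R] M}
    (hrs : r ∘ₗ s = LinearMap.id) (h : extVanish R n G N) : extVanish R n M N := by
  rw [extVanish_iff] at h ⊢
  intro x
  have e : ModuleCat.ofHom s ≫ ModuleCat.ofHom r = 𝟙 M := by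
    rw [← ModuleCat.ofHom_comp, hrs, ModuleCat.ofHom_id]
  rw [← x.mk₀_id_comp, ← e, ← Ext.mk₀_comp_mk₀, Ext.comp_assoc_of_second_deg_zero,
    h ((Ext.mk₀ (ModuleCat.ofHom r)).comp x _), Ext.comp_zero]

namespace IsSES

lemma exists_factorization (h : IsSES f g) (φ : B →ₗ[R] N) (hφ : φ ∘ₗ f = 0) :
    ∃ ψ : C →ₗ[R] N, ψ ∘ₗ g = φ := by
  have := h.shortExact.epi_g
  have hφ' : h.shortComplex.f ≫ ModuleCat.ofHom φ = 0 := by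
    ext a
    exact LinearMap.congr_fun hφ a
  refine ⟨(h.shortExact.exact.desc (ModuleCat.ofHom φ) hφ').hom, ?_⟩
  exact congrArg ModuleCat.Hom.hom (h.shortExact.exact.g_desc (ModuleCat.ofHom φ) hφ')

lemma extVanish_X₂ (h : IsSES f g) (hA : extVanish R n A N) (hC : extVanish R n C N) :
    extVanish R n B N := by
  rw [extVanish_iff] at *
  intro x
  obtain ⟨y, rfl⟩ := Ext.contravariant_sequence_exact₂ h.shortExact _ x (hA _)
  rw [hC y, Ext.comp_zero]

lemma extVanish_X₃ (h : IsSES f g) (hA : extVanish R n A N) (hB : extVanish R (n + 1) B N) :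
    extVanish R (n + 1) C N := by
  rw [extVanish_iff] at *
  intro x
  obtain ⟨y, rfl⟩ := Ext.contravariant_sequence_exact₃ h.shortExact _ x (hB _) (add_comm _ _)
  rw [hA y, Ext.comp_zero]

lemma extVanish_X₁ (h : IsSES f g) (hB : extVanish R n B N) (hC : extVanish R (n + 1) C N) :
    extVanish R n A N := by
  rw [extVanish_iff] at *
  intro x
  obtain ⟨y, rfl⟩ := Ext.contravariant_sequence_exact₁ h.shortExact _ x (add_comm _ _) (hC _)
  rw [hB y, Ext.comp_zero]

lemma extVanish_right_X₁ (h : IsSES f g) (hC : extVanish R n M C)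
    (hB : extVanish R (n + 1) M B) : extVanish R (n + 1) M A := by
  rw [extVanish_iff] at *
  intro x
  obtain ⟨y, rfl⟩ := Ext.covariant_sequence_exact₁ _ h.shortExact x (hB _) rfl
  rw [hC y, Ext.zero_comp]

lemma extVanish_right_X₃ (h : IsSES f g) (hB : extVanish R n M B)
    (hA : extVanish R (n + 1) M A) : extVanish R n M C := by
  rw [extVanish_iff] at *
  intro x
  obtain ⟨y, rfl⟩ := Ext.covariant_sequence_exact₃ _ h.shortExact x rfl (hA _)
  rw [hB y, Ext.zero_comp]

lemma exists_extension (h : IsSES f g) (hC : extVanish R 1 C N) (φ : A →ₗ[R] N) :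
    ∃ ψ : B →ₗ[R] N, ψ ∘ₗ f = φ := by
  rw [extVanish_iff] at hC
  obtain ⟨y, hy⟩ := Ext.contravariant_sequence_exact₁ h.shortExact _
    (Ext.mk₀ (ModuleCat.ofHom φ)) (add_comm _ _) (hC _)
  obtain ⟨ψ, rfl⟩ := Ext.homEquiv₀.symm.surjective y
  refine ⟨ψ.hom, ?_⟩
  have : ModuleCat.ofHom f ≫ ψ = ModuleCat.ofHom φ :=
    Ext.homEquiv₀.symm.injective (by simpa using hy)
  simpa using congrArg ModuleCat.Hom.hom this

lemma extVanish_of_exists_extension (h : IsSES f g) (hB : extVanish R 1 B N)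
    (hext : ∀ φ : A →ₗ[R] N, ∃ ψ : B →ₗ[R] N, ψ ∘ₗ f = φ) : extVanish R 1 C N := by
  rw [extVanish_iff] at *
  intro x
  obtain ⟨y, rfl⟩ := Ext.contravariant_sequence_exact₃ h.shortExact _ x (hB _) (add_comm _ _)
  obtain ⟨φ, rfl⟩ := Ext.homEquiv₀.symm.surjective y
  obtain ⟨ψ, hψ⟩ := hext φ.hom
  have : φ = ModuleCat.ofHom f ≫ ModuleCat.ofHom ψ := by
    rw [← ModuleCat.ofHom_comp, hψ]
    rfl
  rw [Ext.homEquiv₀_symm_apply, this, ← Ext.mk₀_comp_mk₀]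
  exact h.shortExact.extClass_comp_assoc _

lemma exists_retraction (h : IsSES f g) (hC : extVanish R 1 C A) :
    ∃ r : B →ₗ[R] A, r ∘ₗ f = LinearMap.id :=
  h.exists_extension hC LinearMap.id

lemma exists_section (h : IsSES f g) (hC : extVanish R 1 C A) :
    ∃ s : C →ₗ[R] B, g ∘ₗ s = LinearMap.id := by
  have e := (LinearMap.exact_iff.2 h.exact.symm).split_tfae'.out 0 1
  exact (e.2 ⟨h.surj, h.exists_retraction hC⟩).2

end IsSES

end ExtVanishing

section ProjectiveDimension

variable {R : Type u} [Ring R]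

lemma exists_surjective_of_projective (M : ModuleCat.{u} R) :
    ∃ (P : ModuleCat.{u} R) (g : P →ₗ[R] M), Module.Projective R P ∧ Function.Surjective g :=
  ⟨ModuleCat.of R (M →₀ R), Finsupp.linearCombination R id, inferInstanceAs
    (Module.Projective R (M →₀ R)), Finsupp.linearCombination_id_surjective R M⟩

lemma exists_injective_into_injective (M : ModuleCat.{u} R) :
    ∃ (I : ModuleCat.{u} R) (f : M →ₗ[R] I), Module.Injective R I ∧ Function.Injective f :=
  ⟨Injective.under M, (Injective.ι M).hom,
    Module.injective_module_of_injective_object R _ (inj := Injective.injective_under M),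
    (ModuleCat.mono_iff_injective _).1 inferInstance⟩

lemma projDimLE_iff {n : ℕ} {M : ModuleCat.{u} R} :
    projDimLE R n M ↔ HasProjectiveDimensionLE M n := by
  induction n generalizing M with
  | zero =>
    exact (IsProjective.iff_projective M).trans projective_iff_hasProjectiveDimensionLT_one
  | succ n ih =>
    constructor
    · rintro ⟨K, P, f, g, hP, hf, hg, hfg, hK⟩
      have h : IsSES f g := ⟨hf, hg, hfg⟩
      exact (h.shortExact.hasProjectiveDimensionLT_X₃_iff n
        ((IsProjective.iff_projective P).1 hP)).2 (ih.1 hK)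
    · intro hM
      obtain ⟨P, g, hP, hg⟩ := exists_surjective_of_projective M
      have h := isSES_ker hg
      exact ⟨_, P, _, g, hP, h.inj, hg, h.exact,
        ih.2 ((h.shortExact.hasProjectiveDimensionLT_X₃_iff n
        ((IsProjective.iff_projective P).1 hP)).1 hM)⟩

lemma sInf_natCast_ne_top_iff {p : ℕ → Prop} :
    sInf {n : ℕ∞ | ∃ m : ℕ, n = (m : ℕ∞) ∧ p m} ≠ ⊤ ↔ ∃ m, p m := by
  rw [Ne, sInf_eq_top]
  push Not
  constructor
  · rintro ⟨_, ⟨m, rfl, hm⟩, -⟩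
    exact ⟨m, hm⟩
  · rintro ⟨m, hm⟩
    exact ⟨m, ⟨m, rfl, hm⟩, ENat.natCast_ne_top m⟩

lemma exists_of_sInf_natCast_le {p : ℕ → Prop} {n : ℕ}
    (h : sInf {k : ℕ∞ | ∃ m : ℕ, k = (m : ℕ∞) ∧ p m} ≤ n) : ∃ m ≤ n, p m := by
  have hne : {k : ℕ∞ | ∃ m : ℕ, k = (m : ℕ∞) ∧ p m}.Nonempty := by
    by_contra he
    rw [Set.not_nonempty_iff_eq_empty.1 he, sInf_empty, top_le_iff] at h
    exact ENat.natCast_ne_top n h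
  obtain ⟨m, hm, hp⟩ := csInf_mem hne
  exact ⟨m, by rw [hm] at h; exact_mod_cast h, hp⟩

/-- `M` has finite projective dimension. -/
def HasFiniteProjDim (M : ModuleCat.{u} R) : Prop :=
  ∃ n, HasProjectiveDimensionLE M n

lemma projDim_ne_top_iff {M : ModuleCat.{u} R} : projDim R M ≠ ⊤ ↔ HasFiniteProjDim M :=
  sInf_natCast_ne_top_iff.trans (exists_congr fun _ ↦ projDimLE_iff)

lemma exists_hasProjectiveDimensionLE_of_FPD_ne_top (h : FPD R ≠ ⊤) :
    ∃ n, ∀ M : ModuleCat.{u} R, HasFiniteProjDim M → HasProjectiveDimensionLE M n := by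
  obtain ⟨n, hn⟩ := ENat.ne_top_iff_exists.1 h
  refine ⟨n, fun M hM ↦ ?_⟩
  have hle : projDim R M ≤ n := by
    rw [hn]
    exact le_iSup₂_of_le M (projDim_ne_top_iff.2 hM) le_rfl
  obtain ⟨m, hm, hp⟩ := exists_of_sInf_natCast_le hle
  have := projDimLE_iff.1 hp
  exact hasProjectiveDimensionLT_of_ge M (m + 1) (n + 1) (by lia)

lemma HasFiniteProjDim.of_projective {P : ModuleCat.{u} R} (hP : Module.Projective R P) :
    HasFiniteProjDim P :=
  ⟨0, projDimLE_iff.1 hP⟩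

lemma HasFiniteProjDim.of_retract {M H : ModuleCat.{u} R} {s : M →ₗ[R] H} {r : H →ₗ[R] M}
    (hrs : r ∘ₗ s = LinearMap.id) (hH : HasFiniteProjDim H) : HasFiniteProjDim M := by
  obtain ⟨n, hn⟩ := hH
  let e : Retract M H :=
    { i := ModuleCat.ofHom s
      r := ModuleCat.ofHom r
      retract := by rw [← ModuleCat.ofHom_comp, hrs, ModuleCat.ofHom_id] }
  exact ⟨n, e.hasProjectiveDimensionLT (n + 1)⟩

lemma IsSES.hasFiniteProjDim_X₃ {A B C : ModuleCat.{u} R} {f : A →ₗ[R] B} {g : B →ₗ[R] C}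
    (h : IsSES f g) (hA : HasFiniteProjDim A) (hB : HasFiniteProjDim B) :
    HasFiniteProjDim C := by
  obtain ⟨m, hm⟩ := hA
  obtain ⟨n, hn⟩ := hB
  exact ⟨m + n + 1, h.shortExact.hasProjectiveDimensionLT_X₃ (m + n + 1)
    (hasProjectiveDimensionLT_of_ge A (m + 1) _ (by lia))
    (hasProjectiveDimensionLT_of_ge B (n + 1) _ (by lia))⟩

end ProjectiveDimension

section GorensteinProjectiveClass

variable {R : Type u} [Ring R]

/-- A class of modules closed under suitable syzygies and cosyzygies with respect to projective
modules, and left `Ext¹`-orthogonal to the projective modules. -/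
structure IsGorensteinProjectiveClass (X : ModuleCat.{u} R → Prop) : Prop where
  exists_surjective : ∀ M, X M → ∃ (P : ModuleCat.{u} R) (g : P →ₗ[R] M),
    Module.Projective R P ∧ Function.Surjective g ∧ X (ModuleCat.of R (LinearMap.ker g))
  exists_injective : ∀ M, X M → ∃ (P : ModuleCat.{u} R) (f : M →ₗ[R] P),
    Module.Projective R P ∧ Function.Injective f ∧ X (ModuleCat.of R (P ⧸ LinearMap.range f))
  extVanish_one : ∀ M, X M → ∀ Q : ModuleCat.{u} R, Module.Projective R Q → extVanish R 1 M Q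

lemma exists_int_chain {α : Type*} {r : α → α → Prop} (hs : ∀ a, ∃ b, r a b)
    (hp : ∀ a, ∃ b, r b a) (a : α) : ∃ Z : ℤ → α, Z 0 = a ∧ ∀ i, r (Z i) (Z (i + 1)) := by
  choose s hs using hs
  choose p hp using hp
  let Z : ℤ → α
    | .ofNat k => s^[k] a
    | .negSucc k => p^[k + 1] a
  refine ⟨Z, rfl, fun i ↦ ?_⟩
  match i with
  | .ofNat k =>
    change r (s^[k] a) (s^[k + 1] a)
    rw [Function.iterate_succ_apply']
    exact hs _
  | .negSucc 0 => exact hp a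
  | .negSucc (k + 1) =>
    change r (p^[k + 1 + 1] a) (p^[k + 1] a)
    rw [Function.iterate_succ_apply' p (k + 1)]
    exact hp _

lemma IsGorensteinProjectiveClass.isGorensteinProjective {X : ModuleCat.{u} R → Prop}
    (hX : IsGorensteinProjectiveClass X) {M : ModuleCat.{u} R} (hM : X M) :
    IsGorensteinProjective R M := by
  let r : {M // X M} → {M // X M} → Prop := fun A C ↦
    ∃ (P : ModuleCat.{u} R) (f : A.1 →ₗ[R] P) (g : P →ₗ[R] C.1),
      Module.Projective R P ∧ IsSES f g
  obtain ⟨W, hW0, hW⟩ := exists_int_chain (r := r)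
    (fun A ↦ by
      obtain ⟨P, f, hP, hf, hC⟩ := hX.exists_injective A.1 A.2
      exact ⟨⟨_, hC⟩, P, f, _, hP, isSES_quotient hf⟩)
    (fun C ↦ by
      obtain ⟨P, g, hP, hg, hK⟩ := hX.exists_surjective C.1 C.2
      exact ⟨⟨_, hK⟩, P, _, g, hP, isSES_ker hg⟩) ⟨M, hM⟩
  obtain ⟨Z, hZ1, hZ⟩ : ∃ Z : ℤ → {M // X M}, Z (0 + 1) = ⟨M, hM⟩ ∧ ∀ i, r (Z i) (Z (i + 1)) :=
    ⟨fun i ↦ W (i - 1), by simpa using hW0, fun i ↦ by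
      simpa only [sub_add_cancel, add_sub_cancel_right] using hW (i - 1)⟩
  choose P f g hP h using hZ
  have hrange (i : ℤ) : LinearMap.range (f (i + 1) ∘ₗ g i) = LinearMap.range (f (i + 1)) :=
    LinearMap.range_comp_of_range_eq_top _ (LinearMap.range_eq_top.2 (h i).surj)
  refine ⟨P, fun i ↦ f (i + 1) ∘ₗ g i, hP, fun i ↦ ?_, ?_, fun Q hQ i φ hφ ↦ ?_⟩
  · rw [hrange, (h (i + 1)).exact, LinearMap.ker_comp_of_ker_eq_bot _
      (LinearMap.ker_eq_bot.2 (h (i + 1 + 1)).inj)]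
  · have e : Nonempty (M ≃ₗ[R] (Z (0 + 1)).1) := by
      rw [hZ1]
      exact ⟨.refl R M⟩
    rw [hrange]
    exact e.map (·.trans (LinearEquiv.ofInjective _ (h (0 + 1)).inj))
  · obtain ⟨ψ, hψ⟩ := (h (i + 1)).exists_factorization φ (by
      rw [← LinearMap.cancel_right (h i).surj, LinearMap.comp_assoc, hφ, LinearMap.zero_comp])
    obtain ⟨χ, hχ⟩ := (h (i + 1 + 1)).exists_extension
      (hX.extVanish_one _ (Z (i + 1 + 1 + 1)).2 Q hQ) ψ
    exact ⟨χ, by rw [← LinearMap.comp_assoc, hχ, hψ]⟩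

end GorensteinProjectiveClass

section GorensteinProjective

variable {R : Type u} [Ring R]

/-- An exact complex of projective modules which stays exact after applying `Hom(-, Q)` for
projective modules `Q`. -/
structure IsTotallyAcyclic (P : ℤ → ModuleCat.{u} R) (d : ∀ i : ℤ, P i →ₗ[R] P (i + 1)) :
    Prop where
  projective : ∀ i, Module.Projective R (P i)
  exact : ∀ i, LinearMap.range (d i) = LinearMap.ker (d (i + 1))
  exists_factorization : ∀ (Q : ModuleCat.{u} R), Module.Projective R Q →
    ∀ (i : ℤ) (f : P (i + 1) →ₗ[R] Q), f ∘ₗ d i = 0 →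
      ∃ g : P (i + 1 + 1) →ₗ[R] Q, g ∘ₗ d (i + 1) = f

lemma IsTotallyAcyclic.extVanish_range {P : ℤ → ModuleCat.{u} R}
    {d : ∀ i : ℤ, P i →ₗ[R] P (i + 1)} (h : IsTotallyAcyclic P d) (i : ℤ) {Q : ModuleCat.{u} R}
    (hQ : Module.Projective R Q) : extVanish R 1 (ModuleCat.of R (LinearMap.range (d i))) Q := by
  obtain ⟨j, rfl⟩ : ∃ j, i = j + 1 + 1 := ⟨i - 2, by ring⟩
  have hses : IsSES (A := ModuleCat.of R (LinearMap.ker (d (j + 1 + 1))))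
      (C := ModuleCat.of R (LinearMap.range (d (j + 1 + 1))))
      (LinearMap.ker (d (j + 1 + 1))).subtype (d (j + 1 + 1)).rangeRestrict :=
    ⟨Subtype.val_injective, LinearMap.surjective_rangeRestrict _, by
      rw [Submodule.range_subtype, LinearMap.ker_rangeRestrict]⟩
  refine hses.extVanish_of_exists_extension (extVanish_of_projective (h.projective _)) fun φ ↦ ?_
  let δ : P (j + 1) →ₗ[R] LinearMap.ker (d (j + 1 + 1)) :=
    (d (j + 1)).codRestrict _ fun x ↦ h.exact (j + 1) ▸ LinearMap.mem_range_self _ x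
  obtain ⟨ψ, hψ⟩ := h.exists_factorization Q hQ j (φ ∘ₗ δ) (by
    ext x
    have : δ (d j x) = 0 := Subtype.ext <| by
      have : d j x ∈ LinearMap.ker (d (j + 1)) := h.exact j ▸ LinearMap.mem_range_self _ x
      exact this
    simp [this])
  refine ⟨ψ, LinearMap.ext fun ⟨x, hx⟩ ↦ ?_⟩
  rw [← h.exact] at hx
  obtain ⟨y, rfl⟩ := hx
  exact LinearMap.congr_fun hψ y

lemma isGorensteinProjectiveClass_range : IsGorensteinProjectiveClass fun M : ModuleCat.{u} R ↦
    ∃ (P : ℤ → ModuleCat.{u} R) (d : ∀ i : ℤ, P i →ₗ[R] P (i + 1)), IsTotallyAcyclic P d ∧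
      ∃ i, Nonempty (M ≃ₗ[R] LinearMap.range (d i)) where
  exists_surjective := by
    rintro M ⟨P, d, h, i, ⟨e⟩⟩
    obtain ⟨j, rfl⟩ : ∃ j, i = j + 1 := ⟨i - 1, by ring⟩
    refine ⟨P (j + 1), e.symm.toLinearMap ∘ₗ (d (j + 1)).rangeRestrict, h.projective _,
      e.symm.surjective.comp (LinearMap.surjective_rangeRestrict _), P, d, h, j,
      ⟨LinearEquiv.ofEq _ _ ?_⟩⟩
    rw [LinearEquiv.ker_comp, LinearMap.ker_rangeRestrict, h.exact]
  exists_injective := by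
    rintro M ⟨P, d, h, i, ⟨e⟩⟩
    refine ⟨P (i + 1), (LinearMap.range (d i)).subtype ∘ₗ e.toLinearMap, h.projective _,
      Subtype.val_injective.comp e.injective, P, d, h, i + 1,
      ⟨(Submodule.quotEquivOfEq _ _ ?_).trans (d (i + 1)).quotKerEquivRange⟩⟩
    rw [LinearMap.range_comp, LinearEquiv.range, Submodule.map_top, Submodule.range_subtype,
      h.exact]
  extVanish_one := by
    rintro M ⟨P, d, h, i, ⟨e⟩⟩ Q hQ
    exact extVanish_of_retract (G := ModuleCat.of R (LinearMap.range (d i)))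
      (s := e.toLinearMap) (r := e.symm.toLinearMap) (by ext; simp) (h.extVanish_range i hQ)

lemma isGorensteinProjectiveClass_isGorensteinProjective :
    IsGorensteinProjectiveClass (IsGorensteinProjective R) := by
  have h := isGorensteinProjectiveClass_range (R := R)
  have hiff (M : ModuleCat.{u} R) : IsGorensteinProjective R M ↔
      ∃ (P : ℤ → ModuleCat.{u} R) (d : ∀ i : ℤ, P i →ₗ[R] P (i + 1)), IsTotallyAcyclic P d ∧
      ∃ i, Nonempty (M ≃ₗ[R] LinearMap.range (d i)) :=
    ⟨fun ⟨P, d, hP, hd, he, hQ⟩ ↦ ⟨P, d, ⟨hP, hd, hQ⟩, 0, he⟩, h.isGorensteinProjective⟩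
  rwa [funext fun M ↦ propext (hiff M)]

namespace IsGorensteinProjective

variable {G N : ModuleCat.{u} R}

lemma exists_surjective (hG : IsGorensteinProjective R G) :
    ∃ (K P : ModuleCat.{u} R) (f : K →ₗ[R] P) (g : P →ₗ[R] G),
      Module.Projective R P ∧ IsGorensteinProjective R K ∧ IsSES f g := by
  obtain ⟨P, g, hP, hg, hK⟩ :=
    isGorensteinProjectiveClass_isGorensteinProjective.exists_surjective G hG
  exact ⟨_, P, _, g, hP, hK, isSES_ker hg⟩

lemma exists_injective (hG : IsGorensteinProjective R G) :
    ∃ (P C : ModuleCat.{u} R) (f : G →ₗ[R] P) (g : P →ₗ[R] C),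
      Module.Projective R P ∧ IsGorensteinProjective R C ∧ IsSES f g := by
  obtain ⟨P, f, hP, hf, hC⟩ :=
    isGorensteinProjectiveClass_isGorensteinProjective.exists_injective G hG
  exact ⟨P, _, f, _, hP, hC, isSES_quotient hf⟩

lemma extVanish_projective (hG : IsGorensteinProjective R G) (hN : Module.Projective R N) (n : ℕ) :
    extVanish R (n + 1) G N := by
  induction n generalizing G with
  | zero => exact isGorensteinProjectiveClass_isGorensteinProjective.extVanish_one G hG N hN
  | succ n ih =>
    obtain ⟨K, P, f, g, hP, hK, h⟩ := hG.exists_surjective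
    exact h.extVanish_X₃ (ih hK) (extVanish_of_projective hP)

lemma extVanish (hG : IsGorensteinProjective R G) (hN : HasFiniteProjDim N) (n : ℕ) :
    extVanish R (n + 1) G N := by
  obtain ⟨m, hm⟩ := hN
  rw [← projDimLE_iff] at hm
  induction m generalizing N n with
  | zero => exact hG.extVanish_projective hm n
  | succ m ih =>
    obtain ⟨K, P, f, g, hP, hf, hg, hfg, hK⟩ := hm
    exact IsSES.extVanish_right_X₃ ⟨hf, hg, hfg⟩ (hG.extVanish_projective hP n) (ih (n + 1) hK)

end IsGorensteinProjective

end GorensteinProjective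

section Horseshoe

variable {R : Type u} [Ring R] {A B C : ModuleCat.{u} R} {i : A →ₗ[R] B} {p : B →ₗ[R] C}

lemma IsSES.horseshoe_ker (h : IsSES i p) {PA PC : ModuleCat.{u} R} {a : PA →ₗ[R] A}
    (ha : Function.Surjective a) {c : PC →ₗ[R] B} (hc : Function.Surjective (p ∘ₗ c)) :
    Function.Surjective ((i ∘ₗ a).coprod c) ∧
    ∃ (j : LinearMap.ker a →ₗ[R] LinearMap.ker ((i ∘ₗ a).coprod c))
      (q : LinearMap.ker ((i ∘ₗ a).coprod c) →ₗ[R] LinearMap.ker (p ∘ₗ c)),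
      IsSES (A := ModuleCat.of R (LinearMap.ker a))
        (B := ModuleCat.of R (LinearMap.ker ((i ∘ₗ a).coprod c)))
        (C := ModuleCat.of R (LinearMap.ker (p ∘ₗ c))) j q := by
  refine ⟨fun b ↦ ?_, (LinearMap.inl R PA PC ∘ₗ (LinearMap.ker a).subtype).codRestrict _ ?_,
    (LinearMap.snd R PA PC ∘ₗ (LinearMap.ker ((i ∘ₗ a).coprod c)).subtype).codRestrict _ ?_,
    ?_, ?_, ?_⟩
  · obtain ⟨y, hy⟩ := hc (p b)
    obtain ⟨z, hz⟩ := h.exists_of_apply_eq_zero (b := b - c y)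
      (by simpa [sub_eq_zero] using hy.symm)
    obtain ⟨x, rfl⟩ := ha z
    exact ⟨(x, y), by simp [hz]⟩
  · rintro ⟨x, hx⟩
    simp [LinearMap.mem_ker.1 hx]
  · rintro ⟨⟨x, y⟩, hxy⟩
    have := congrArg p (LinearMap.mem_ker.1 hxy)
    simpa [h.apply_apply] using this
  · rintro ⟨x, hx⟩ ⟨x', hx'⟩ hxx
    simpa [Subtype.ext_iff] using hxx
  · rintro ⟨y, hy⟩
    obtain ⟨z, hz⟩ := h.exists_of_apply_eq_zero (b := c y) hy
    obtain ⟨x, rfl⟩ := ha z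
    exact ⟨⟨(-x, y), by simp [hz]⟩, rfl⟩
  · ext ⟨⟨x, y⟩, hxy⟩
    simp only [LinearMap.mem_range, LinearMap.mem_ker, Subtype.ext_iff, Subtype.exists]
    constructor
    · rintro ⟨x', hx', e⟩
      exact (Prod.ext_iff.1 e).2.symm
    · intro hy
      obtain rfl : y = 0 := hy
      refine ⟨x, h.inj ?_, rfl⟩
      simpa using hxy

lemma IsSES.horseshoe_coker (h : IsSES i p) {PA PC : ModuleCat.{u} R} {a : B →ₗ[R] PA}
    (ha : Function.Injective (a ∘ₗ i)) {c : C →ₗ[R] PC} (hc : Function.Injective c) :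
    Function.Injective (a.prod (c ∘ₗ p)) ∧
    ∃ (j : (PA ⧸ LinearMap.range (a ∘ₗ i)) →ₗ[R] ((PA × PC) ⧸ LinearMap.range (a.prod (c ∘ₗ p))))
      (q : ((PA × PC) ⧸ LinearMap.range (a.prod (c ∘ₗ p))) →ₗ[R] (PC ⧸ LinearMap.range c)),
      IsSES (A := ModuleCat.of R (PA ⧸ LinearMap.range (a ∘ₗ i)))
        (B := ModuleCat.of R ((PA × PC) ⧸ LinearMap.range (a.prod (c ∘ₗ p))))
        (C := ModuleCat.of R (PC ⧸ LinearMap.range c)) j q := by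
  refine ⟨(injective_iff_map_eq_zero _).2 fun b hb ↦ ?_,
    Submodule.mapQ _ _ (LinearMap.inl R PA PC) ?_, Submodule.mapQ _ _ (LinearMap.snd R PA PC) ?_,
    (injective_iff_map_eq_zero _).2 ?_, ?_, ?_⟩
  · have hb' : a b = 0 ∧ c (p b) = 0 := by simpa using hb
    obtain ⟨x, rfl⟩ := h.exists_of_apply_eq_zero ((map_eq_zero_iff c hc).1 hb'.2)
    rw [(map_eq_zero_iff (a ∘ₗ i) ha).1 hb'.1, map_zero]
  · rintro _ ⟨x, rfl⟩
    exact ⟨i x, by simp [h.apply_apply]⟩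
  · rintro _ ⟨b, rfl⟩
    exact ⟨p b, by simp⟩
  · intro x hx
    induction x using Submodule.Quotient.induction_on with | _ x
    obtain ⟨b, hb⟩ := (Submodule.Quotient.mk_eq_zero _).1 hx
    have hb' : a b = x ∧ c (p b) = 0 := by simpa using hb
    obtain ⟨z, rfl⟩ := h.exists_of_apply_eq_zero ((map_eq_zero_iff c hc).1 hb'.2)
    exact (Submodule.Quotient.mk_eq_zero _).2 ⟨z, hb'.1⟩
  · intro y
    induction y using Submodule.Quotient.induction_on with | _ y
    exact ⟨Submodule.Quotient.mk (0, y), rfl⟩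
  · ext z
    induction z using Submodule.Quotient.induction_on with | _ z
    obtain ⟨x, y⟩ := z
    constructor
    · rintro ⟨x', hx'⟩
      rw [← hx']
      induction x' using Submodule.Quotient.induction_on with | _ x'
      exact (Submodule.Quotient.mk_eq_zero _).2 ⟨0, by simp⟩
    · intro hy
      obtain ⟨w, rfl⟩ := (Submodule.Quotient.mk_eq_zero _).1 hy
      obtain ⟨b, rfl⟩ := h.surj w
      refine ⟨Submodule.Quotient.mk (x - a b), (Submodule.Quotient.eq _).2 ⟨-b, ?_⟩⟩
      simp

lemma IsGorensteinProjective.of_isSES (h : IsSES i p) (hA : IsGorensteinProjective R A)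
    (hC : IsGorensteinProjective R C) : IsGorensteinProjective R B := by
  have hGP := isGorensteinProjectiveClass_isGorensteinProjective (R := R)
  refine IsGorensteinProjectiveClass.isGorensteinProjective
    (X := fun B ↦ ∃ (A C : ModuleCat.{u} R) (i : A →ₗ[R] B) (p : B →ₗ[R] C),
      IsSES i p ∧ IsGorensteinProjective R A ∧ IsGorensteinProjective R C)
    ⟨?_, ?_, ?_⟩ ⟨A, C, i, p, h, hA, hC⟩
  · rintro B ⟨A, C, i, p, h, hA, hC⟩
    obtain ⟨PA, a, hPA, ha, hKA⟩ := hGP.exists_surjective A hA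
    obtain ⟨PC, c, hPC, hc, hKC⟩ := hGP.exists_surjective C hC
    obtain ⟨c, rfl⟩ := Module.projective_lifting_property p c h.surj
    obtain ⟨hs, j, q, hjq⟩ := h.horseshoe_ker ha hc
    exact ⟨ModuleCat.of R (PA × PC), _, inferInstanceAs (Module.Projective R (PA × PC)), hs,
      _, _, j, q, hjq, hKA, hKC⟩
  · rintro B ⟨A, C, i, p, h, hA, hC⟩
    obtain ⟨PA, a, hPA, ha, hCA⟩ := hGP.exists_injective A hA
    obtain ⟨PC, c, hPC, hc, hCC⟩ := hGP.exists_injective C hC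
    obtain ⟨a, rfl⟩ := h.exists_extension (hGP.extVanish_one C hC PA hPA) a
    obtain ⟨hs, j, q, hjq⟩ := h.horseshoe_coker ha hc
    exact ⟨ModuleCat.of R (PA × PC), _, inferInstanceAs (Module.Projective R (PA × PC)), hs,
      _, _, j, q, hjq, hCA, hCC⟩
  · rintro B ⟨A, C, i, p, h, hA, hC⟩ Q hQ
    exact h.extVanish_X₂ (hGP.extVanish_one A hA Q hQ) (hGP.extVanish_one C hC Q hQ)

end Horseshoe

section Approximations

variable {R : Type u} [Ring R] {M : ModuleCat.{u} R}

lemma IsSES.exists_isSES_of_pushout {A B C H X : ModuleCat.{u} R} {f : A →ₗ[R] B} {g : B →ₗ[R] C}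
    (h : IsSES f g) {φ : A →ₗ[R] H} {q : B × H →ₗ[R] X}
    (hq : IsSES (B := ModuleCat.of R (B × H)) (f.prod φ) q) :
    ∃ b : X →ₗ[R] C, IsSES (q ∘ₗ LinearMap.inr R B H) b := by
  obtain ⟨b, hb⟩ := hq.exists_factorization (g ∘ₗ LinearMap.fst R B H)
    (by ext x; exact h.apply_apply x)
  have hb' (z : B × H) : b (q z) = g z.1 := LinearMap.congr_fun hb z
  refine ⟨b, (injective_iff_map_eq_zero _).2 fun y hy ↦ ?_, fun z ↦ ?_, ?_⟩
  · obtain ⟨x, hx⟩ := hq.exists_of_apply_eq_zero hy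
    obtain ⟨hx₁, hx₂⟩ : f x = 0 ∧ φ x = y := Prod.ext_iff.1 hx
    rw [← hx₂, (map_eq_zero_iff f h.inj).1 hx₁, map_zero]
  · obtain ⟨y, rfl⟩ := h.surj z
    exact ⟨q (y, 0), hb' _⟩
  · ext x
    obtain ⟨⟨y, z⟩, rfl⟩ := hq.surj x
    constructor
    · rintro ⟨w, hw⟩
      rw [LinearMap.mem_ker, ← hw]
      exact (hb' (0, w)).trans (map_zero g)
    · intro hx
      obtain ⟨w, rfl⟩ := h.exists_of_apply_eq_zero ((hb' _).symm.trans hx)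
      refine ⟨z - φ w, ?_⟩
      have hw : q (f w, φ w) = 0 := hq.apply_apply w
      have : ((f w, z) : B × H) = (0, z - φ w) + (f w, φ w) := by simp
      rw [this, map_add, hw, add_zero]
      rfl

lemma IsSES.exists_pushout {A B C H D : ModuleCat.{u} R} {f : A →ₗ[R] B} {g : B →ₗ[R] C}
    {φ : A →ₗ[R] H} {ψ : H →ₗ[R] D} (h : IsSES f g) (h' : IsSES φ ψ) :
    ∃ (X : ModuleCat.{u} R) (a : H →ₗ[R] X) (b : X →ₗ[R] C) (a' : B →ₗ[R] X) (b' : X →ₗ[R] D),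
      IsSES a b ∧ IsSES a' b' := by
  have hinj : Function.Injective (f.prod φ) := fun x y hxy ↦ h.inj (Prod.ext_iff.1 hxy).1
  have hq := isSES_quotient (B := ModuleCat.of R (B × H)) hinj
  have hq' : IsSES (B := ModuleCat.of R (H × B)) (φ.prod f)
      (C := ModuleCat.of R ((B × H) ⧸ LinearMap.range (f.prod φ)))
      ((LinearMap.range (f.prod φ)).mkQ ∘ₗ (LinearEquiv.prodComm R H B).toLinearMap) := by
    refine ⟨fun x y hxy ↦ h'.inj (Prod.ext_iff.1 hxy).1,
      hq.surj.comp (LinearEquiv.prodComm R H B).surjective, ?_⟩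
    ext ⟨y, z⟩
    simp [Prod.ext_iff, and_comm]
  obtain ⟨b, hb⟩ := h.exists_isSES_of_pushout hq
  obtain ⟨b', hb'⟩ := h'.exists_isSES_of_pushout hq'
  exact ⟨_, _, b, _, b', hb, hb'⟩

lemma IsSES.exists_isSES_quotient_comp {K G P C : ModuleCat.{u} R} {f : K →ₗ[R] G}
    {g : G →ₗ[R] M} {i : G →ₗ[R] P} {p : P →ₗ[R] C} (h : IsSES f g) (h' : IsSES i p) :
    ∃ (a : M →ₗ[R] P ⧸ LinearMap.range (i ∘ₗ f)) (b : P ⧸ LinearMap.range (i ∘ₗ f) →ₗ[R] C),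
      IsSES (B := ModuleCat.of R (P ⧸ LinearMap.range (i ∘ₗ f))) a b := by
  obtain ⟨a, ha⟩ := h.exists_factorization
    (N := ModuleCat.of R (P ⧸ LinearMap.range (i ∘ₗ f)))
    ((LinearMap.range (i ∘ₗ f)).mkQ ∘ₗ i) (by
      ext x
      exact (Submodule.Quotient.mk_eq_zero _).2 ⟨x, rfl⟩)
  have ha' (y : G) : a (g y) = Submodule.Quotient.mk (i y) := LinearMap.congr_fun ha y
  have hle : LinearMap.range (i ∘ₗ f) ≤ LinearMap.ker p := by
    rintro _ ⟨x, rfl⟩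
    exact h'.apply_apply _
  refine ⟨a, (LinearMap.range (i ∘ₗ f)).liftQ p hle, (injective_iff_map_eq_zero _).2 fun m hm ↦ ?_,
    fun c ↦ ?_, ?_⟩
  · obtain ⟨y, rfl⟩ := h.surj m
    rw [ha'] at hm
    obtain ⟨x, hx⟩ := (Submodule.Quotient.mk_eq_zero _).1 hm
    rw [← h'.inj hx, h.apply_apply]
  · obtain ⟨y, rfl⟩ := h'.surj c
    exact ⟨Submodule.Quotient.mk y, rfl⟩
  · ext x
    constructor
    · rintro ⟨m, rfl⟩
      obtain ⟨y, rfl⟩ := h.surj m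
      rw [ha']
      exact h'.apply_apply y
    · intro hx
      induction x using Submodule.Quotient.induction_on with | _ x
      obtain ⟨y, rfl⟩ := h'.exists_of_apply_eq_zero (b := x) hx
      exact ⟨g y, ha' y⟩

/-- A special preenvelope of `M` by a module of finite projective dimension is obtained from a
special Gorenstein projective precover of `M`. -/
lemma IsSES.exists_isSES_hasFiniteProjDim {K G : ModuleCat.{u} R} {f : K →ₗ[R] G}
    {g : G →ₗ[R] M} (h : IsSES f g) (hK : HasFiniteProjDim K) (hG : IsGorensteinProjective R G) :
    ∃ (H C : ModuleCat.{u} R) (a : M →ₗ[R] H) (b : H →ₗ[R] C),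
      HasFiniteProjDim H ∧ IsGorensteinProjective R C ∧ IsSES a b := by
  obtain ⟨P, C, i, p, hP, hC, hi⟩ := hG.exists_injective
  obtain ⟨a, b, hab⟩ := h.exists_isSES_quotient_comp hi
  have hKP := isSES_quotient (f := i ∘ₗ f) (hi.inj.comp h.inj)
  exact ⟨_, C, a, b, hKP.hasFiniteProjDim_X₃ hK (.of_projective hP), hC, hab⟩

lemma exists_isSES_isGorensteinProjective_of_gpdLE {n : ℕ} (h : gpdLE R n M) :
    ∃ (K G : ModuleCat.{u} R) (f : K →ₗ[R] G) (g : G →ₗ[R] M),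
      HasFiniteProjDim K ∧ IsGorensteinProjective R G ∧ IsSES f g := by
  induction n generalizing M with
  | zero =>
    refine ⟨ModuleCat.of R PUnit.{u + 1}, M, 0, LinearMap.id,
      .of_projective (inferInstanceAs (Module.Projective R PUnit.{u + 1})), h,
      Function.injective_of_subsingleton _, Function.surjective_id, by simp⟩
  | succ n ih =>
    obtain ⟨K, G, f, g, hG, hf, hg, hfg, hK⟩ := h
    obtain ⟨L, G', f', g', hL, hG', h'⟩ := ih hK
    obtain ⟨H, C, a, b, hH, hC, hab⟩ := h'.exists_isSES_hasFiniteProjDim hL hG'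
    obtain ⟨X, s, t, s', t', hst, hst'⟩ := IsSES.exists_pushout ⟨hf, hg, hfg⟩ hab
    exact ⟨H, X, s, t, hH, .of_isSES hst' hG hC, hst⟩

/-- The left Ext-orthogonal of the modules of finite projective dimension is a class of
Gorenstein projective modules, provided that its members have special Gorenstein projective
precovers. -/
lemma isGorensteinProjectiveClass_leftOrthogonal (hR : ∀ M : ModuleCat.{u} R, ∃ n, gpdLE R n M) :
    IsGorensteinProjectiveClass fun M : ModuleCat.{u} R ↦
      ∀ N : ModuleCat.{u} R, HasFiniteProjDim N → extVanish R 1 M N := by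
  have hretract (M : ModuleCat.{u} R)
      (hM : ∀ N : ModuleCat.{u} R, HasFiniteProjDim N → extVanish R 1 M N) :
      ∃ (G : ModuleCat.{u} R) (s : M →ₗ[R] G) (r : G →ₗ[R] M),
        IsGorensteinProjective R G ∧ r ∘ₗ s = LinearMap.id := by
    obtain ⟨n, hn⟩ := hR M
    obtain ⟨K, G, f, g, hK, hG, h⟩ := exists_isSES_isGorensteinProjective_of_gpdLE hn
    obtain ⟨s, hs⟩ := h.exists_section (hM K hK)
    exact ⟨G, s, g, hG, hs⟩
  refine ⟨fun M hM ↦ ?_, fun M hM ↦ ?_, fun M hM Q hQ ↦ hM Q (.of_projective hQ)⟩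
  · obtain ⟨G, s, r, hG, hrs⟩ := hretract M hM
    obtain ⟨P, g, hP, hg⟩ := exists_surjective_of_projective M
    exact ⟨P, g, hP, hg, fun N hN ↦ (isSES_ker hg).extVanish_X₁ (extVanish_of_projective hP)
      (extVanish_of_retract hrs (hG.extVanish hN 1))⟩
  · obtain ⟨G, s, r, hG, hrs⟩ := hretract M hM
    obtain ⟨P, C, i, p, hP, hC, h⟩ := hG.exists_injective
    have hs : Function.Injective s :=
      Function.LeftInverse.injective (g := r) (LinearMap.congr_fun hrs)
    have his : Function.Injective (i ∘ₗ s) := h.inj.comp hs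
    refine ⟨P, i ∘ₗ s, hP, his, fun N hN ↦
      (isSES_quotient his).extVanish_of_exists_extension (extVanish_of_projective hP)
        fun φ ↦ ?_⟩
    obtain ⟨ψ, hψ⟩ := h.exists_extension (hC.extVanish hN 0) (φ ∘ₗ r)
    exact ⟨ψ, by rw [← LinearMap.comp_assoc, hψ, LinearMap.comp_assoc, hrs, LinearMap.comp_id]⟩

lemma HasFiniteProjDim.of_extVanish_of_gpdLE {n : ℕ} (hn : gpdLE R n M)
    (hM : ∀ G, IsGorensteinProjective R G → extVanish R 1 G M) : HasFiniteProjDim M := by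
  obtain ⟨K, G, f, g, hK, hG, h⟩ := exists_isSES_isGorensteinProjective_of_gpdLE hn
  obtain ⟨H, C, a, b, hH, hC, hab⟩ := h.exists_isSES_hasFiniteProjDim hK hG
  obtain ⟨r, hr⟩ := hab.exists_retraction (hM C hC)
  exact hH.of_retract hr

end Approximations

section FiniteFinitisticDimension

variable {R : Type u} [Ring R] {M N : ModuleCat.{u} R}

lemma extVanish_succ_of_forall_hasFiniteProjDim {k : ℕ}
    (hinj : ∀ J : ModuleCat.{u} R, Module.Injective R J → HasFiniteProjDim J)
    (hN : HasFiniteProjDim N)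
    (h : ∀ C : ModuleCat.{u} R, HasFiniteProjDim C → extVanish R (k + 1) C N) :
    extVanish R (k + 1) M N := by
  induction k generalizing N with
  | zero =>
    obtain ⟨J, i, hJ, hi⟩ := exists_injective_into_injective N
    have hses := isSES_quotient hi
    obtain ⟨r, hr⟩ := hses.exists_retraction (h _ (hses.hasFiniteProjDim_X₃ hN (hinj J hJ)))
    refine extVanish_of_injective ⟨fun X Y _ _ _ _ f hf g ↦ ?_⟩
    obtain ⟨g', hg'⟩ := hJ.out f hf (i ∘ₗ g)
    exact ⟨r ∘ₗ g', fun x ↦ by simpa [hg'] using LinearMap.congr_fun hr (g x)⟩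
  | succ k ih =>
    obtain ⟨J, i, hJ, hi⟩ := exists_injective_into_injective N
    have hses := isSES_quotient hi
    exact hses.extVanish_right_X₁ (ih (hses.hasFiniteProjDim_X₃ hN (hinj J hJ)) fun C hC ↦
      hses.extVanish_right_X₃ (extVanish_of_injective hJ) (h C hC)) (extVanish_of_injective hJ)

lemma gpdLE_of_forall_extVanish
    (hGP : ∀ M : ModuleCat.{u} R, (∀ N : ModuleCat.{u} R, HasFiniteProjDim N → extVanish R 1 M N) →
      IsGorensteinProjective R M) {k : ℕ}
    (h : ∀ N : ModuleCat.{u} R, HasFiniteProjDim N → extVanish R (k + 1) M N) : gpdLE R k M := by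
  induction k generalizing M with
  | zero => exact hGP M h
  | succ k ih =>
    obtain ⟨P, g, hP, hg⟩ := exists_surjective_of_projective M
    have hses := isSES_ker hg
    exact ⟨_, P, _, g, hGP P fun _ _ ↦ extVanish_of_projective hP, hses.inj, hses.surj, hses.exact,
      ih fun N hN ↦ hses.extVanish_X₁ (extVanish_of_projective hP) (h N hN)⟩

end FiniteFinitisticDimension

/-- If `FPD(R) < ∞`, then `l.Ggldim(R) < ∞` if and only if `GP(R) = ^⊥(P̄(R))` and
`GP(R)^⊥ = P̄(R)`, where `P̄(R)` is the class of modules of finite projective dimension. -/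
theorem leftGgldim_finite_iff (R : Type u) [Ring R] (hFPD : FPD R ≠ ⊤) :
    leftGgldim R ≠ ⊤ ↔
      ((∀ M : ModuleCat.{u} R, IsGorensteinProjective R M ↔
        ∀ N : ModuleCat.{u} R, projDim R N ≠ ⊤ → extVanish R 1 M N) ∧
      (∀ M : ModuleCat.{u} R,
        (∀ G, IsGorensteinProjective R G → extVanish R 1 G M) ↔ projDim R M ≠ ⊤)) := by
  simp_rw [projDim_ne_top_iff]
  constructor
  · intro h
    have hR (M : ModuleCat.{u} R) : ∃ n, gpdLE R n M :=
      sInf_natCast_ne_top_iff.1 (ne_top_of_le_ne_top h (le_iSup (gpd R) M))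
    refine ⟨fun M ↦ ⟨fun hM N hN ↦ hM.extVanish hN 0,
      (isGorensteinProjectiveClass_leftOrthogonal hR).isGorensteinProjective⟩,
      fun M ↦ ⟨?_, fun hM G hG ↦ hG.extVanish hM 0⟩⟩
    obtain ⟨n, hn⟩ := hR M
    exact .of_extVanish_of_gpdLE hn
  · rintro ⟨hGP, hfin⟩
    obtain ⟨n, hn⟩ := exists_hasProjectiveDimensionLE_of_FPD_ne_top hFPD
    have hinj (J : ModuleCat.{u} R) (hJ : Module.Injective R J) : HasFiniteProjDim J :=
      (hfin J).1 fun _ _ ↦ extVanish_of_injective hJ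
    have hgpd (M : ModuleCat.{u} R) : gpdLE R n M :=
      gpdLE_of_forall_extVanish (fun M ↦ (hGP M).2) fun N hN ↦
        extVanish_succ_of_forall_hasFiniteProjDim hinj hN fun C hC ↦
          extVanish_of_hasProjectiveDimensionLT (hn C hC)
    exact ne_top_of_le_ne_top (ENat.natCast_ne_top n)
      (iSup_le fun M ↦ sInf_le ⟨n, rfl, hgpd M⟩)
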